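/- Fix (z,w) ∈ Λ with z ∈ {0,1} or w ∈ {0,1}. Then for all sufficiently large n ∈ ℕ and every (x,y) ∈ Λ: (a) if Tⁿ(x,y) ∈ [z−b^{−λ(n)}, z+b^{−λ(n)}] × [w−b^{−ξ(n)}, w+b^{−ξ(n)}], then there exists t ∈ Jⁿ with |x − f_t(z,w)_1| ≤ b^{−λ(n)−n} and |y − f_t(z,w)_2| ≤ b^{−ξ(n)−n}; and (b) conversely, if such a t ∈ Jⁿ exists, then Tⁿ(x,y) ∈ ⋃_{(r,s)∈{−1,0,1}²} [z+r−b^{−λ(n)}, z+r+b^{−λ(n)}] × [w+s−b^{−ξ(n)}, w+s+b^{−ξ(n)}]. -/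

import Mathlib

open Set Filter Topology MeasureTheory
open scoped ENNReal NNReal Topology

noncomputable section

namespace ShrinkingRect

/-- The real number with 1-indexed base-`b` digit sequence `u` (digit `i` is `u i` for `i ≥ 1`). -/
def val (b : ℕ) (u : ℕ → ℕ) : ℝ := ∑' i : ℕ, (u (i + 1) : ℝ) / (b : ℝ) ^ (i + 1)

/-- The self-similar carpet `Λ` with digit set `J ⊆ {0,…,b−1}²`. -/
def carpet (b : ℕ) (J : Finset (ℕ × ℕ)) : Set (ℝ × ℝ) :=
  {p | ∃ d : ℕ → ℕ × ℕ, (∀ i, 1 ≤ i → d i ∈ J) ∧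
    p = (val b (fun i => (d i).1), val b (fun i => (d i).2))}

/-- `J₂(a)`: the digits of `J` lying in row `a`. -/
def J2 (J : Finset (ℕ × ℕ)) (a : ℕ) : Finset (ℕ × ℕ) := J.filter fun p => p.2 = a

/-- The contraction `f_{u,v}(x,y) = ((x+u)/b, (y+v)/b)`. -/
def fmap (b : ℕ) (uv : ℕ × ℕ) (p : ℝ × ℝ) : ℝ × ℝ :=
  ((p.1 + (uv.1 : ℝ)) / b, (p.2 + (uv.2 : ℝ)) / b)

/-- `f_t = f_{u₁,v₁} ∘ ⋯ ∘ f_{uₙ,vₙ}` for a finite word `t = ((u₁,v₁),…,(uₙ,vₙ))`. -/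
def fword (b : ℕ) (t : List (ℕ × ℕ)) (p : ℝ × ℝ) : ℝ × ℝ :=
  t.foldr (fmap b) p

/-- The limsup set `W_{λ,ξ}(z,w)`. -/
def Wset (b : ℕ) (J : Finset (ℕ × ℕ)) (lam xi : ℕ → ℕ) (z w : ℝ) : Set (ℝ × ℝ) :=
  {p | p ∈ carpet b J ∧
    {t : List (ℕ × ℕ) | t ≠ [] ∧ (∀ e ∈ t, e ∈ J) ∧
      |p.1 - (fword b t (z, w)).1| ≤ (b : ℝ) ^ (-(lam t.length : ℤ) - (t.length : ℤ)) ∧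
      |p.2 - (fword b t (z, w)).2| ≤ (b : ℝ) ^ (-(xi t.length : ℤ) - (t.length : ℤ))}.Infinite}

/-- The closeness condition (in one coordinate) defining `M_n(z,w)`:
`xd` is the digit string of the point, `zd` that of the centre, `L` is `λ(n)` or `ξ(n)`. -/
def closeCond (b L n : ℕ) (zd xd : ℕ → ℕ) : Prop :=
  (∀ i, 1 ≤ i → i < L → xd (i + n) = zd i) ∨
  (∃ j, 1 ≤ j ∧ j < L ∧ (∀ i, 1 ≤ i → i ≤ j - 1 → xd (i + n) = zd i) ∧
    (((xd (j + n) : ℤ) - (zd j : ℤ) = -1 ∧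
        ∀ i, j + 1 ≤ i → i < L → (xd (i + n) : ℤ) - (zd i : ℤ) = (b : ℤ) - 1) ∨
     ((xd (j + n) : ℤ) - (zd j : ℤ) = 1 ∧
        ∀ i, j + 1 ≤ i → i < L → (zd i : ℤ) - (xd (i + n) : ℤ) = (b : ℤ) - 1)))

/-- A choice of representative digit sequences for the points of the carpet: each point of `Λ`
gets a digit sequence in `J` representing it, whose partial products of row cardinalities
`∏ #J₂(y_i)` are eventually maximal among all representations of that point. -/
structure RepMap (b : ℕ) (J : Finset (ℕ × ℕ)) where
  rep : ℝ × ℝ → ℕ → ℕ × ℕ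
  mem_J : ∀ p ∈ carpet b J, ∀ i, 1 ≤ i → rep p i ∈ J
  eq_val : ∀ p ∈ carpet b J,
    p = (val b (fun i => (rep p i).1), val b (fun i => (rep p i).2))
  maximal : ∀ p ∈ carpet b J, ∀ d : ℕ → ℕ × ℕ, (∀ i, 1 ≤ i → d i ∈ J) →
    p = (val b (fun i => (d i).1), val b (fun i => (d i).2)) →
    ∃ N₀ : ℕ, ∀ N, N₀ ≤ N →
      ∏ i ∈ Finset.Icc 1 N, (J2 J (d i).2).card ≤
        ∏ i ∈ Finset.Icc 1 N, (J2 J (rep p i).2).card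

/-- The expanding map `T(x,y) = (bx − x₁, by − y₁)`, where `(x_i,y_i)` is the representative
digit sequence of `(x,y)`. -/
def Tmap {b : ℕ} {J : Finset (ℕ × ℕ)} (R : RepMap b J) (p : ℝ × ℝ) : ℝ × ℝ :=
  ((b : ℝ) * p.1 - ((R.rep p 1).1 : ℝ), (b : ℝ) * p.2 - ((R.rep p 1).2 : ℝ))

/-- The shrinking target set `Λ_{λ,ξ}(z,w)`. -/
def targetSet {b : ℕ} {J : Finset (ℕ × ℕ)} (R : RepMap b J) (lam xi : ℕ → ℕ)
    (z w : ℝ) : Set (ℝ × ℝ) :=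
  {p | p ∈ carpet b J ∧ ∃ᶠ n in atTop,
    ((Tmap R)^[n] p).1 ∈ Icc (z - (b : ℝ) ^ (-(lam n : ℤ))) (z + (b : ℝ) ^ (-(lam n : ℤ))) ∧
    ((Tmap R)^[n] p).2 ∈ Icc (w - (b : ℝ) ^ (-(xi n : ℤ))) (w + (b : ℝ) ^ (-(xi n : ℤ)))}

/-- The set `M_n(z,w)` (as a set of points of `Λ`, via representative sequences). -/
def Mset {b : ℕ} {J : Finset (ℕ × ℕ)} (R : RepMap b J) (lam xi : ℕ → ℕ)
    (zw : ℝ × ℝ) (n : ℕ) : Set (ℝ × ℝ) :=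
  {p | p ∈ carpet b J ∧
    closeCond b (lam n) n (fun i => (R.rep zw i).1) (fun i => (R.rep p i).1) ∧
    closeCond b (xi n) n (fun i => (R.rep zw i).2) (fun i => (R.rep p i).2)}

/-- `p_{n,j}(a,y) = #{λ(n) ≤ i ≤ j : y_{i+n} = a}`. -/
def pcount {b : ℕ} {J : Finset (ℕ × ℕ)} (R : RepMap b J) (lam : ℕ → ℕ)
    (p : ℝ × ℝ) (a n j : ℕ) : ℕ :=
  ((Finset.Icc (lam n) j).filter fun i => (R.rep p (i + n)).2 = a).card

/-- `A_{n,j}(z,w) = max_{(x,y) ∈ M_n(z,w)} Σ_a p_{n,j}(a,y) log #J₂(a)`. -/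
def Aval {b : ℕ} {J : Finset (ℕ × ℕ)} (R : RepMap b J) (lam xi : ℕ → ℕ)
    (zw : ℝ × ℝ) (n j : ℕ) : ℝ :=
  sSup ((fun p => ∑ a ∈ Finset.range b,
    (pcount R lam p a n j : ℝ) * Real.log ((J2 J a).card)) '' Mset R lam xi zw n)

/-- `s_n = min{ (n log #J + A_{n,j}(z,w)) / ((n+j) log b) : λ(n) ≤ j ≤ ξ(n) }`. -/
def sval {b : ℕ} {J : Finset (ℕ × ℕ)} (R : RepMap b J) (lam xi : ℕ → ℕ)
    (zw : ℝ × ℝ) (n : ℕ) : ℝ :=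
  sInf ((fun j : ℕ => ((n : ℝ) * Real.log J.card + Aval R lam xi zw n j) /
    (((n : ℝ) + (j : ℝ)) * Real.log b)) '' Set.Icc (lam n) (xi n))

/-- `#{1 ≤ i ≤ n : u i = a}`. -/
def freqCount (u : ℕ → ℕ) (a n : ℕ) : ℕ := ((Finset.Icc 1 n).filter fun i => u i = a).card

/-- The second-coordinate digit string of the representative sequence of a point. -/
def wdig {b : ℕ} {J : Finset (ℕ × ℕ)} (R : RepMap b J) (zw : ℝ × ℝ) (i : ℕ) : ℕ :=
  (R.rep zw i).2

lemma summable_digits {b : ℕ} (hb : 2 ≤ b) {u : ℕ → ℕ} (hu : ∀ i, 1 ≤ i → u i < b) :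
    Summable fun i : ℕ => (u (i + 1) : ℝ) / (b : ℝ) ^ (i + 1) := by
  have hsum : Summable fun i : ℕ => ((b : ℝ)⁻¹) ^ i :=
    summable_geometric_of_lt_one (by positivity)
      (inv_lt_one_of_one_lt₀ (by exact_mod_cast (by omega : 1 < b)))
  refine Summable.of_nonneg_of_le (fun i => by positivity) (fun i => ?_) hsum
  have hb0 : (0 : ℝ) < b := by exact_mod_cast (by omega : 0 < b)
  have hub : (u (i + 1) : ℝ) ≤ b := by exact_mod_cast (hu (i + 1) (by omega)).le
  rw [inv_pow, pow_succ, div_le_iff₀ (by positivity), inv_mul_cancel_left₀ (by positivity)]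
  exact hub

lemma val_eq_shift {b : ℕ} (hb : 2 ≤ b) {u : ℕ → ℕ} (hu : ∀ i, 1 ≤ i → u i < b) :
    val b u = (val b (fun i => u (i + 1)) + u 1) / b := by
  have hb0 : (b : ℝ) ≠ 0 := by exact_mod_cast (by omega : b ≠ 0)
  unfold val
  rw [(summable_digits hb hu).tsum_eq_zero_add, add_div, add_comm, ← tsum_div_const]
  congr 1
  · exact tsum_congr fun i => by rw [pow_succ (b : ℝ) (i + 1), div_div]
  · simp

lemma val_nonneg (b : ℕ) (u : ℕ → ℕ) : 0 ≤ val b u :=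
  tsum_nonneg fun _ => by positivity

lemma val_le_one {b : ℕ} (hb : 2 ≤ b) {u : ℕ → ℕ} (hu : ∀ i, 1 ≤ i → u i < b) :
    val b u ≤ 1 := by
  have hb1 : (1 : ℝ) < b := by exact_mod_cast (by omega : 1 < b)
  have hb0 : (0 : ℝ) < b := by linarith
  have hgeom : HasSum (fun i : ℕ => ((b : ℝ) - 1) / b * ((b : ℝ)⁻¹) ^ i) 1 := by
    have h := (hasSum_geometric_of_lt_one (by positivity : (0 : ℝ) ≤ (b : ℝ)⁻¹)
      (inv_lt_one_of_one_lt₀ hb1)).mul_left (((b : ℝ) - 1) / b)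
    have hne : (b : ℝ) - 1 ≠ 0 := by linarith
    have hval : ((b : ℝ) - 1) / b * (1 - (b : ℝ)⁻¹)⁻¹ = 1 := by
      rw [show (1 : ℝ) - (b : ℝ)⁻¹ = ((b : ℝ) - 1) / b by field_simp]
      exact mul_inv_cancel₀ (div_ne_zero hne hb0.ne')
    rwa [hval] at h
  refine hasSum_le (fun i => ?_) (summable_digits hb hu).hasSum hgeom
  have hub : (u (i + 1) : ℝ) ≤ (b : ℝ) - 1 := by
    have : (u (i + 1) : ℝ) + 1 ≤ b := by exact_mod_cast hu (i + 1) (by omega)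
    linarith
  calc (u (i + 1) : ℝ) / (b : ℝ) ^ (i + 1) ≤ ((b : ℝ) - 1) / (b : ℝ) ^ (i + 1) := by gcongr
    _ = ((b : ℝ) - 1) / b * ((b : ℝ)⁻¹) ^ i := by
      rw [inv_pow, pow_succ]
      field_simp

lemma carpet_mem_unit {b : ℕ} {J : Finset (ℕ × ℕ)} (hb : 2 ≤ b)
    (hJ : J ⊆ Finset.range b ×ˢ Finset.range b) {p : ℝ × ℝ} (hp : p ∈ carpet b J) :
    p.1 ∈ Icc (0 : ℝ) 1 ∧ p.2 ∈ Icc (0 : ℝ) 1 := by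
  obtain ⟨d, hd, rfl⟩ := hp
  have hlt : ∀ i, 1 ≤ i → (d i).1 < b ∧ (d i).2 < b := fun i hi => by
    simpa using hJ (hd i hi)
  exact ⟨⟨val_nonneg b fun i => (d i).1, val_le_one hb fun i hi => (hlt i hi).1⟩,
    val_nonneg b fun i => (d i).2, val_le_one hb fun i hi => (hlt i hi).2⟩

lemma fmap_Tmap {b : ℕ} {J : Finset (ℕ × ℕ)} (hb : 2 ≤ b) (R : RepMap b J) (p : ℝ × ℝ) :
    fmap b (R.rep p 1) (Tmap R p) = p := by
  have hb0 : (b : ℝ) ≠ 0 := by exact_mod_cast (by omega : b ≠ 0)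
  ext <;> simp [fmap, Tmap, hb0]

lemma Tmap_mem {b : ℕ} {J : Finset (ℕ × ℕ)} (hb : 2 ≤ b)
    (hJ : J ⊆ Finset.range b ×ˢ Finset.range b) (R : RepMap b J) {p : ℝ × ℝ}
    (hp : p ∈ carpet b J) : Tmap R p ∈ carpet b J := by
  have hlt : ∀ i, 1 ≤ i → (R.rep p i).1 < b ∧ (R.rep p i).2 < b := fun i hi => by
    simpa using hJ (R.mem_J p hp i hi)
  have hb0 : (b : ℝ) ≠ 0 := by exact_mod_cast (by omega : b ≠ 0)
  refine ⟨fun i => R.rep p (i + 1), fun i _ => R.mem_J p hp (i + 1) (by omega), ?_⟩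
  have h1 := congrArg Prod.fst (R.eq_val p hp)
  have h2 := congrArg Prod.snd (R.eq_val p hp)
  dsimp only at h1 h2
  rw [val_eq_shift hb fun i hi => (hlt i hi).1, eq_div_iff hb0] at h1
  rw [val_eq_shift hb fun i hi => (hlt i hi).2, eq_div_iff hb0] at h2
  ext
  · simp only [Tmap]; linarith
  · simp only [Tmap]; linarith

lemma exists_fword_iterate_Tmap {b : ℕ} {J : Finset (ℕ × ℕ)} (hb : 2 ≤ b)
    (hJ : J ⊆ Finset.range b ×ˢ Finset.range b) (R : RepMap b J) (n : ℕ) :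
    ∀ p ∈ carpet b J, (Tmap R)^[n] p ∈ carpet b J ∧
      ∃ t : List (ℕ × ℕ), t.length = n ∧ (∀ e ∈ t, e ∈ J) ∧
        fword b t ((Tmap R)^[n] p) = p := by
  induction n with
  | zero => exact fun p hp => ⟨hp, [], rfl, by simp, rfl⟩
  | succ n ih =>
    intro p hp
    obtain ⟨hmem, t, ht, htJ, hword⟩ := ih _ (Tmap_mem hb hJ R hp)
    refine ⟨hmem, R.rep p 1 :: t, by simp [ht], ?_, ?_⟩
    · simpa using ⟨R.mem_J p hp 1 le_rfl, fun a c h => htJ (a, c) h⟩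
    · change fmap b _ (fword b t _) = p
      rw [Function.iterate_succ_apply, hword, fmap_Tmap hb]

lemma exists_fword_eq {b : ℕ} (hb : 2 ≤ b) (t : List (ℕ × ℕ)) :
    ∃ A B : ℤ, ∀ q : ℝ × ℝ, (fword b t q).1 = (q.1 + A) / (b : ℝ) ^ t.length ∧
      (fword b t q).2 = (q.2 + B) / (b : ℝ) ^ t.length := by
  have hb0 : (b : ℝ) ≠ 0 := by exact_mod_cast (by omega : b ≠ 0)
  induction t with
  | nil => exact ⟨0, 0, fun q => by simp [fword]⟩
  | cons e t ih =>
    obtain ⟨A, B, h⟩ := ih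
    refine ⟨A + e.1 * (b : ℤ) ^ t.length, B + e.2 * (b : ℤ) ^ t.length, fun q => ?_⟩
    have hcons : fword b (e :: t) q = fmap b e (fword b t q) := rfl
    constructor <;>
    · simp only [hcons, fmap, h q, List.length_cons]
      push_cast
      field_simp
      ring

lemma abs_div_pow_sub_le_iff {b : ℕ} (hb : 2 ≤ b) (X Y : ℝ) (L n : ℕ) :
    |X / (b : ℝ) ^ n - Y / (b : ℝ) ^ n| ≤ (b : ℝ) ^ (-(L : ℤ) - (n : ℤ)) ↔
      |X - Y| ≤ (b : ℝ) ^ (-(L : ℤ)) := by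
  have hb0 : (0 : ℝ) < b := by exact_mod_cast (by omega : 0 < b)
  rw [← sub_div, abs_div, abs_of_pos (pow_pos hb0 n), zpow_sub₀ hb0.ne', zpow_natCast,
    div_le_div_iff_of_pos_right (pow_pos hb0 n)]

/-- An integer translate of a point of `[0,1]` close to a point of `[0,1]` is a translate by
`-1`, `0` or `1`. -/
lemma exists_translate {b : ℕ} (hb : 2 ≤ b) {X z : ℝ} (hX : X ∈ Icc (0 : ℝ) 1)
    (hz : z ∈ Icc (0 : ℝ) 1) {A B : ℤ} {L : ℕ} (hL : 1 ≤ L)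
    (h : |(X + A) - (z + B)| ≤ (b : ℝ) ^ (-(L : ℤ))) :
    ∃ r ∈ ({-1, 0, 1} : Set ℝ),
      X ∈ Icc (z + r - (b : ℝ) ^ (-(L : ℤ))) (z + r + (b : ℝ) ^ (-(L : ℤ))) := by
  have hlt : (b : ℝ) ^ (-(L : ℤ)) < 1 := by
    rw [zpow_neg, zpow_natCast]
    exact inv_lt_one_of_one_lt₀
      (one_lt_pow₀ (by exact_mod_cast (by omega : 1 < b)) (by omega))
  obtain ⟨hl, hu⟩ := abs_le.mp h
  obtain ⟨hX0, hX1⟩ := hX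
  obtain ⟨hz0, hz1⟩ := hz
  have h1 : B - A < 2 := by
    have : ((B - A : ℤ) : ℝ) < 2 := by push_cast; linarith
    exact_mod_cast this
  have h2 : -2 < B - A := by
    have : (-2 : ℝ) < ((B - A : ℤ) : ℝ) := by push_cast; linarith
    exact_mod_cast this
  refine ⟨((B - A : ℤ) : ℝ), ?_, ?_, ?_⟩
  · have hcases : B - A = -1 ∨ B - A = 0 ∨ B - A = 1 := by omega
    rcases hcases with h | h | h <;> simp [h]
  · push_cast; linarith
  · push_cast; linarith

theorem stmt_9
    (b : ℕ) (J : Finset (ℕ × ℕ)) (hb : 2 ≤ b)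
    (hJ : J ⊂ Finset.range b ×ˢ Finset.range b) (hJcard : 2 ≤ J.card)
    (R : RepMap b J) (lam xi : ℕ → ℕ)
    (hlam_pos : ∀ n, 1 ≤ lam n) (hle : ∀ n, lam n ≤ xi n)
    (hlam_top : Tendsto lam atTop atTop)
    (z w : ℝ) (hzw : (z, w) ∈ carpet b J)
    (h01 : z = 0 ∨ z = 1 ∨ w = 0 ∨ w = 1) :
    ∀ᶠ n in atTop, ∀ p ∈ carpet b J,
      ((((Tmap R)^[n] p).1 ∈
        Icc (z - (b : ℝ) ^ (-(lam n : ℤ))) (z + (b : ℝ) ^ (-(lam n : ℤ))) ∧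
      ((Tmap R)^[n] p).2 ∈
        Icc (w - (b : ℝ) ^ (-(xi n : ℤ))) (w + (b : ℝ) ^ (-(xi n : ℤ)))) →
        (∃ t : List (ℕ × ℕ), t.length = n ∧ (∀ e ∈ t, e ∈ J) ∧
        |p.1 - (fword b t (z, w)).1| ≤ (b : ℝ) ^ (-(lam n : ℤ) - (n : ℤ)) ∧
        |p.2 - (fword b t (z, w)).2| ≤ (b : ℝ) ^ (-(xi n : ℤ) - (n : ℤ)))) ∧
      ((∃ t : List (ℕ × ℕ), t.length = n ∧ (∀ e ∈ t, e ∈ J) ∧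
        |p.1 - (fword b t (z, w)).1| ≤ (b : ℝ) ^ (-(lam n : ℤ) - (n : ℤ)) ∧
        |p.2 - (fword b t (z, w)).2| ≤ (b : ℝ) ^ (-(xi n : ℤ) - (n : ℤ))) →
        ∃ r ∈ ({-1, 0, 1} : Set ℝ), ∃ s ∈ ({-1, 0, 1} : Set ℝ),
          ((Tmap R)^[n] p).1 ∈
            Icc (z + r - (b : ℝ) ^ (-(lam n : ℤ))) (z + r + (b : ℝ) ^ (-(lam n : ℤ))) ∧
          ((Tmap R)^[n] p).2 ∈
            Icc (w + s - (b : ℝ) ^ (-(xi n : ℤ))) (w + s + (b : ℝ) ^ (-(xi n : ℤ)))) := by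
  refine Eventually.of_forall fun n p hp => ?_
  obtain ⟨hmem, t, rfl, htJ, hword⟩ := exists_fword_iterate_Tmap hb hJ.subset R n p hp
  obtain ⟨A, B, hAB⟩ := exists_fword_eq hb t
  have hp1 := (hAB ((Tmap R)^[t.length] p)).1
  have hp2 := (hAB ((Tmap R)^[t.length] p)).2
  rw [hword] at hp1 hp2
  obtain ⟨hX, hY⟩ := carpet_mem_unit hb hJ.subset hmem
  obtain ⟨hz, hw⟩ := carpet_mem_unit hb hJ.subset hzw
  constructor
  · rintro ⟨⟨h1, h2⟩, h3, h4⟩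
    refine ⟨t, rfl, htJ, ?_, ?_⟩
    · rw [hp1, (hAB (z, w)).1, abs_div_pow_sub_le_iff hb, add_sub_add_right_eq_sub, abs_le]
      constructor <;> dsimp only <;> linarith
    · rw [hp2, (hAB (z, w)).2, abs_div_pow_sub_le_iff hb, add_sub_add_right_eq_sub, abs_le]
      constructor <;> dsimp only <;> linarith
  · rintro ⟨s, hs, -, h1, h2⟩
    obtain ⟨C, D, hCD⟩ := exists_fword_eq hb s
    rw [hp1, (hCD (z, w)).1, hs, abs_div_pow_sub_le_iff hb] at h1
    rw [hp2, (hCD (z, w)).2, hs, abs_div_pow_sub_le_iff hb] at h2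
    obtain ⟨r, hr, hr'⟩ := exists_translate hb hX hz (hlam_pos _) h1
    obtain ⟨r₂, hr₂, hr₂'⟩ := exists_translate hb hY hw ((hlam_pos _).trans (hle _)) h2
    exact ⟨r, hr, r₂, hr₂, hr', hr₂'⟩

end ShrinkingRect
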